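/- arXiv:1307.5138 — 5 statements merged into one kernel-verified Lean document; each statement's English description precedes it below -/
import Mathlib

section
/- Structure of the modified illumination complex of a simplex: Let Δ = conv{a_0,…,a_d} ⊂ ℝ^d be a non-degenerate simplex with barycenter at the origin and let S be a finite non-empty set. Then the modified illumination complex B(Δ, S) is homeomorphic to the geometric realization J(d+1, S) of the (d+1)-fold join S^{*(d+1)}. -/
noncomputable section

/-- The facet `F i = conv {a j : j ≠ i}` of the simplex with vertex set `a`,
opposite the vertex `a i`. -/
def facet {d : ℕ} (a : Fin (d + 1) → EuclideanSpace ℝ (Fin d)) (i : Fin (d + 1)) :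
    Set (EuclideanSpace ℝ (Fin d)) :=
  convexHull ℝ (a '' {j | j ≠ i})

/-- The identification generating the modified illumination complex `B(Δ, S)`:
`(x, f) ∼ (x, g)` iff `f i = g i` for every `i` with `x ∉ F i`. -/
def BRel {d : ℕ} (a : Fin (d + 1) → EuclideanSpace ℝ (Fin d)) (S : Type*)
    (p q : ↥(convexHull ℝ (Set.range a)) × (Fin (d + 1) → S)) : Prop :=
  p.1 = q.1 ∧ ∀ i : Fin (d + 1), (p.1 : EuclideanSpace ℝ (Fin d)) ∉ facet a i →
    p.2 i = q.2 i

/-- The modified illumination complex `B(Δ, S) = (Δ × Fun({0,…,d}, S)) / ∼`,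
with the quotient topology. -/
abbrev BComplex {d : ℕ} (a : Fin (d + 1) → EuclideanSpace ℝ (Fin d)) (S : Type*) :=
  Quot (BRel a S)

/-- The geometric realization of the `n`-fold join `S^{*n}` of a finite set `S`:
`J(n, S) = {β : Fin n × S → ℝ : β ≥ 0, ∑ β = 1, and for each i at most one
s ∈ S has β (i, s) > 0}`, topologized as a subspace of `ℝ^{n|S|}`. -/
abbrev JoinSpace (n : ℕ) (S : Type*) [Fintype S] :=
  {β : Fin n × S → ℝ //
    (∀ p, 0 ≤ β p) ∧ (∑ p, β p = 1) ∧
      ∀ (i : Fin n) (s s' : S), 0 < β (i, s) → 0 < β (i, s') → s = s'}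

/-- A family of `d + 1` points of `ℝ^d` whose difference vectors from the first point are linearly
independent, as an affine basis. -/
def simplexBasis {d : ℕ} (a : Fin (d + 1) → EuclideanSpace ℝ (Fin d))
    (h : LinearIndependent ℝ (fun i : Fin d => a i.succ - a 0)) :
    AffineBasis (Fin (d + 1)) ℝ (EuclideanSpace ℝ (Fin d)) :=
  have ha : AffineIndependent ℝ a := by
    rw [affineIndependent_iff_linearIndependent_vsub ℝ a 0,
      ← linearIndependent_equiv (finSuccAboveEquiv (0 : Fin (d + 1)))]
    exact h
  ⟨a, ha, ha.affineSpan_eq_top_iff_card_eq_finrank_add_one.2 (by simp)⟩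

theorem AffineBasis.coord_nonneg_of_mem_convexHull {ι E : Type*} [AddCommGroup E] [Module ℝ E]
    (b : AffineBasis ι ℝ E) {x : E} (hx : x ∈ convexHull ℝ (Set.range b)) (i : ι) :
    0 ≤ b.coord i x := by
  rw [b.convexHull_eq_nonneg_coord] at hx
  exact hx i

theorem mem_facet_iff_coord_eq_zero {d : ℕ}
    (b : AffineBasis (Fin (d + 1)) ℝ (EuclideanSpace ℝ (Fin d)))
    {x : EuclideanSpace ℝ (Fin d)} (hx : x ∈ convexHull ℝ (Set.range b)) (i : Fin (d + 1)) :
    x ∈ facet b i ↔ b.coord i x = 0 := by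
  constructor
  · intro h
    have hconv : Convex ℝ (b.coord i ⁻¹' {0}) := (convex_singleton 0).affine_preimage _
    refine convexHull_min ?_ hconv h
    rintro _ ⟨j, hj, rfl⟩
    exact b.coord_apply_ne (Ne.symm hj)
  · intro h
    have hsum := b.sum_coord_apply_eq_one x
    have hcomb := b.linear_combination_coord_eq_self x
    rw [← Finset.add_sum_erase _ _ (Finset.mem_univ i), h] at hsum hcomb
    rw [zero_add] at hsum
    rw [zero_smul, zero_add] at hcomb
    rw [← hcomb]
    refine (convex_convexHull ℝ _).sum_mem (fun j _ => b.coord_nonneg_of_mem_convexHull hx j) hsum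
      fun j hj => ?_
    exact subset_convexHull ℝ _ ⟨j, Finset.ne_of_mem_erase hj, rfl⟩

open Classical in
/-- The weight function on `Fin (d + 1) × S` that puts the `i`-th barycentric coordinate of a point
of the simplex on the color `f i`. -/
def coloredCoord {d : ℕ} (b : AffineBasis (Fin (d + 1)) ℝ (EuclideanSpace ℝ (Fin d)))
    {S : Type*} (p : ↥(convexHull ℝ (Set.range b)) × (Fin (d + 1) → S)) :
    Fin (d + 1) × S → ℝ :=
  fun q => if p.2 q.1 = q.2 then b.coord q.1 p.1 else 0

section

variable {d : ℕ} (b : AffineBasis (Fin (d + 1)) ℝ (EuclideanSpace ℝ (Fin d))) {S : Type*}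

theorem sum_coloredCoord [Fintype S] (p : ↥(convexHull ℝ (Set.range b)) × (Fin (d + 1) → S))
    (i : Fin (d + 1)) : ∑ s, coloredCoord b p (i, s) = b.coord i p.1 := by
  classical simp [coloredCoord]

theorem coloredCoord_self (p : ↥(convexHull ℝ (Set.range b)) × (Fin (d + 1) → S))
    (i : Fin (d + 1)) : coloredCoord b p (i, p.2 i) = b.coord i p.1 := by
  simp [coloredCoord]

theorem eq_of_coloredCoord_ne_zero {p : ↥(convexHull ℝ (Set.range b)) × (Fin (d + 1) → S)}
    {i : Fin (d + 1)} {s : S} (h : coloredCoord b p (i, s) ≠ 0) : p.2 i = s := by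
  by_contra hs
  exact h (if_neg hs)

theorem continuous_coloredCoord [Finite S] [TopologicalSpace S] [DiscreteTopology S] :
    Continuous (coloredCoord b (S := S)) := by
  rw [continuous_prod_of_discrete_right]
  refine fun f => continuous_pi fun q => ?_
  simp only [coloredCoord]
  split_ifs
  · exact (b.coord q.1).continuous_of_finiteDimensional.comp continuous_subtype_val
  · exact continuous_const

theorem coloredCoord_eq_iff [Fintype S]
    (p q : ↥(convexHull ℝ (Set.range b)) × (Fin (d + 1) → S)) :
    coloredCoord b p = coloredCoord b q ↔ BRel b S p q := by
  constructor
  · intro h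
    have hcoord (i : Fin (d + 1)) : b.coord i p.1 = b.coord i q.1 := by
      rw [← sum_coloredCoord, ← sum_coloredCoord, h]
    refine ⟨Subtype.ext (b.ext_elem hcoord), fun i hi => ?_⟩
    rw [mem_facet_iff_coord_eq_zero b p.1.2, hcoord, ← coloredCoord_self, ← h] at hi
    exact eq_of_coloredCoord_ne_zero b hi
  · rintro ⟨hx, hf⟩
    ext ⟨i, s⟩
    by_cases hi : (p.1 : EuclideanSpace ℝ (Fin d)) ∈ facet b i
    · rw [mem_facet_iff_coord_eq_zero b p.1.2] at hi
      simp [coloredCoord, ← hx, hi]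
    · simp only [coloredCoord, ← hx]
      rw [hf i hi]

/-- `coloredCoord` as a map into the join. -/
def toJoinSpace [Fintype S] (p : ↥(convexHull ℝ (Set.range b)) × (Fin (d + 1) → S)) :
    JoinSpace (d + 1) S :=
  ⟨coloredCoord b p, by
    refine ⟨fun q => ?_, ?_, fun i s s' hs hs' => ?_⟩
    · unfold coloredCoord
      split_ifs
      exacts [b.coord_nonneg_of_mem_convexHull p.1.2 q.1, le_rfl]
    · simp_rw [Fintype.sum_prod_type, sum_coloredCoord]
      exact b.sum_coord_apply_eq_one _
    · rw [← eq_of_coloredCoord_ne_zero b hs.ne', ← eq_of_coloredCoord_ne_zero b hs'.ne']⟩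

theorem toJoinSpace_surjective [Fintype S] [Nonempty S] :
    Function.Surjective (toJoinSpace b (S := S)) := by
  rintro ⟨β, hnonneg, hsum, huniq⟩
  have hcolor (i : Fin (d + 1)) : ∃ s, ∀ t, t ≠ s → β (i, t) = 0 := by
    by_cases h : ∃ s, 0 < β (i, s)
    · obtain ⟨s, hs⟩ := h
      exact ⟨s, fun t ht => le_antisymm
        (not_lt.1 fun hpos => ht (huniq i t s hpos hs)) (hnonneg _)⟩
    · push Not at h
      exact ⟨Classical.arbitrary S, fun t _ => le_antisymm (h t) (hnonneg _)⟩
  choose f hf using hcolor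
  have hweight (i : Fin (d + 1)) : ∑ s, β (i, s) = β (i, f i) :=
    Fintype.sum_eq_single _ (hf i)
  simp_rw [Fintype.sum_prod_type, hweight] at hsum
  let x := Finset.univ.affineCombination ℝ b fun i => β (i, f i)
  have hx (i : Fin (d + 1)) : b.coord i x = β (i, f i) :=
    b.coord_apply_combination_of_mem (Finset.mem_univ i) hsum
  have hmem : x ∈ convexHull ℝ (Set.range b) := by
    rw [b.convexHull_eq_nonneg_coord]
    exact fun i => (hnonneg _).trans_eq (hx i).symm
  refine ⟨(⟨x, hmem⟩, f), Subtype.ext (funext fun ⟨i, s⟩ => ?_)⟩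
  change coloredCoord b (⟨x, hmem⟩, f) (i, s) = β (i, s)
  by_cases hs : f i = s
  · simp [coloredCoord, ← hs, hx]
  · simp [coloredCoord, hs, hf i s (Ne.symm hs)]

/-- The modified illumination complex of the simplex spanned by an affine basis is homeomorphic
to the join. -/
theorem nonempty_BComplex_homeomorph_joinSpace [Fintype S] [Nonempty S] [TopologicalSpace S]
    [DiscreteTopology S] : Nonempty (BComplex b S ≃ₜ JoinSpace (d + 1) S) := by
  have : CompactSpace ↥(convexHull ℝ (Set.range b)) :=
    isCompact_iff_compactSpace.1 ((Set.finite_range b).isCompact_convexHull ℝ)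
  let g : BComplex b S → JoinSpace (d + 1) S :=
    Quot.lift (toJoinSpace b) fun p q h => Subtype.ext ((coloredCoord_eq_iff b p q).2 h)
  have hcont : Continuous g :=
    continuous_quot_lift _ ((continuous_coloredCoord b).subtype_mk _)
  have hbij : Function.Bijective g := by
    constructor
    · rintro ⟨p⟩ ⟨q⟩ h
      exact Quot.sound ((coloredCoord_eq_iff b p q).1 (congrArg Subtype.val h))
    · exact (Quot.surjective_lift _).2 (toJoinSpace_surjective b)
  exact ⟨Continuous.homeoOfEquivCompactToT2 (f := Equiv.ofBijective g hbij) hcont⟩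

end

/-- **Structure of the modified illumination complex of a simplex.** For a
non-degenerate simplex `Δ ⊂ ℝ^d` with barycenter at the origin and a finite
non-empty set `S` of colors, `B(Δ, S)` is homeomorphic to the geometric realization
of the `(d+1)`-fold join `S^{*(d+1)}`. -/
theorem BComplex_homeomorphic_join (d : ℕ)
    (a : Fin (d + 1) → EuclideanSpace ℝ (Fin d))
    (hnondeg : LinearIndependent ℝ (fun i : Fin d => a i.succ - a 0))
    (hbary : ∑ i, a i = 0)
    (S : Type) [Fintype S] [Nonempty S] [TopologicalSpace S] [DiscreteTopology S] :
    Nonempty (BComplex a S ≃ₜ JoinSpace (d + 1) S) := by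
  exact nonempty_BComplex_homeomorph_joinSpace (simplexBasis a hnondeg)
end
end

section
/- Structure of the illumination complex of the Δ-zonotope: Let Δ = conv{a_0,…,a_d} ⊂ ℝ^d be a non-degenerate simplex with barycenter at the origin, let R_Δ be the associated Δ-zonotope, and let S be a finite non-empty set. Then the illumination complex A(R_Δ, F_Δ, S) is homeomorphic to the geometric realization J(d+1, S) of the (d+1)-fold join S^{*(d+1)}; moreover the homeomorphism can be chosen equivariantly with respect to every permutation π of S, where π acts on A(R_Δ, F_Δ, S) by (x,f) ↦ (x, π∘f) and on J(d+1,S) by permuting the S-coordinates, β(i,s) ↦ β(i, π^{-1}(s)). -/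
noncomputable section

/-- The cone over the facet `F i = conv {a j | j ≠ i}` of the simplex with vertex
set `a`, with apex at the origin: `cone(F i) = {∑_{j ≠ i} t j • a j : t j ≥ 0}`. -/
def coneFace {d : ℕ} (a : Fin (d + 1) → EuclideanSpace ℝ (Fin d)) (i : Fin (d + 1)) :
    Set (EuclideanSpace ℝ (Fin d)) :=
  {z | ∃ t : Fin (d + 1) → ℝ, (∀ k, 0 ≤ t k) ∧ t i = 0 ∧ z = ∑ k, t k • a k}

/-- The Δ-zonotope `R_Δ = [0, a 0] + [0, a 1] + ⋯ + [0, a d]`, the Minkowski sum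
of the segments `[0, a i] = {t • a i : 0 ≤ t ≤ 1}`. -/
def zonotope {d : ℕ} (a : Fin (d + 1) → EuclideanSpace ℝ (Fin d)) :
    Set (EuclideanSpace ℝ (Fin d)) :=
  {z | ∃ t : Fin (d + 1) → ℝ, (∀ k, t k ∈ Set.Icc (0 : ℝ) 1) ∧ z = ∑ k, t k • a k}

/-- The identification generating the illumination complex `A(R_Δ, F_Δ, S)`:
`(x, f) ∼ (x, g)` iff `f i = g i` for every `i` such that
`int (x + cone (F i)) ∩ int (R_Δ) ≠ ∅`. -/
def ARel {d : ℕ} (a : Fin (d + 1) → EuclideanSpace ℝ (Fin d)) (S : Type*)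
    (p q : ↥(zonotope a) × (Fin (d + 1) → S)) : Prop :=
  p.1 = q.1 ∧ ∀ i : Fin (d + 1),
    (interior (((p.1 : EuclideanSpace ℝ (Fin d)) + ·) '' coneFace a i) ∩
        interior (zonotope a)).Nonempty →
    p.2 i = q.2 i

/-- The illumination complex `A(R_Δ, F_Δ, S) = (R_Δ × Fun({0,…,d}, S)) / ∼`,
with the quotient topology. -/
abbrev AComplex {d : ℕ} (a : Fin (d + 1) → EuclideanSpace ℝ (Fin d)) (S : Type*) :=
  Quot (ARel a S)

/-- The translate of `t` by a multiple of `(1, …, 1)` whose largest coordinate is `1`. -/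
def maxNormalize {n : ℕ} (t : Fin (n + 1) → ℝ) (k : Fin (n + 1)) : ℝ :=
  t k - Finset.univ.sup' Finset.univ_nonempty t + 1

lemma maxNormalize_le_one {n : ℕ} (t : Fin (n + 1) → ℝ) (k : Fin (n + 1)) :
    maxNormalize t k ≤ 1 := by
  have := Finset.le_sup' t (Finset.mem_univ k)
  unfold maxNormalize
  linarith

lemma exists_forall_maxNormalize_eq {n : ℕ} (t : Fin (n + 1) → ℝ) :
    ∃ j, (∀ k, t k ≤ t j) ∧ ∀ k, maxNormalize t k = t k - t j + 1 := by
  obtain ⟨j, -, hj⟩ := Finset.exists_mem_eq_sup' (Finset.univ_nonempty) t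
  refine ⟨j, fun k => ?_, fun k => ?_⟩
  · rw [← hj]
    exact Finset.le_sup' t (Finset.mem_univ k)
  · rw [maxNormalize, hj]

lemma maxNormalize_congr {n : ℕ} {t u : Fin (n + 1) → ℝ}
    (h : ∀ j k, t j - t k = u j - u k) : maxNormalize t = maxNormalize u := by
  obtain ⟨i, hi, hti⟩ := exists_forall_maxNormalize_eq t
  obtain ⟨j, hj, huj⟩ := exists_forall_maxNormalize_eq u
  have hij : u i = u j := le_antisymm (hj i) (by linarith [hi j, h j i])
  funext k
  rw [hti, huj, h k i, hij]

lemma continuous_maxNormalize {n : ℕ} :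
    Continuous (maxNormalize : (Fin (n + 1) → ℝ) → Fin (n + 1) → ℝ) := by
  refine continuous_pi fun k => ((continuous_apply k).sub ?_).add continuous_const
  exact Continuous.finset_sup'_apply _ fun i _ => continuous_apply i

lemma sum_maxNormalize_pos {n : ℕ} {t : Fin (n + 1) → ℝ} (h : ∀ k, 0 ≤ maxNormalize t k) :
    0 < ∑ k, maxNormalize t k := by
  obtain ⟨j, -, hj⟩ := exists_forall_maxNormalize_eq t
  exact Finset.sum_pos' (fun k _ => h k) ⟨j, Finset.mem_univ j, by simp [hj j]⟩

/-- `σ` sends each point to coefficients expressing it in terms of the vectors `a k`, and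
coefficients are determined up to multiples of `(1, …, 1)`. -/
structure IsCoordinateSection {d : ℕ} (a : Fin (d + 1) → EuclideanSpace ℝ (Fin d))
    (σ : EuclideanSpace ℝ (Fin d) →L[ℝ] (Fin (d + 1) → ℝ)) : Prop where
  sum_smul : ∀ z, ∑ k, σ z k • a k = z
  apply_sub_apply : ∀ (t : Fin (d + 1) → ℝ) (j k : Fin (d + 1)),
    σ (∑ l, t l • a l) j - σ (∑ l, t l • a l) k = t j - t k

section

variable {d : ℕ} {a : Fin (d + 1) → EuclideanSpace ℝ (Fin d)}

lemma eq_of_sum_smul_eq_zero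
    (hnondeg : LinearIndependent ℝ (fun i : Fin d => a i.succ - a 0))
    (hbary : ∑ i, a i = 0) {t : Fin (d + 1) → ℝ} (ht : ∑ k, t k • a k = 0)
    (j k : Fin (d + 1)) : t j = t k := by
  set m : ℝ := (∑ l, t l) / (d + 1) with hm
  have hd : (d + 1 : ℝ) ≠ 0 := by positivity
  have hsum : (t 0 - m) + ∑ i : Fin d, (t i.succ - m) = 0 := by
    rw [← Fin.sum_univ_succ (fun l => t l - m), Finset.sum_sub_distrib]
    simp only [Finset.sum_const, Finset.card_univ, Fintype.card_fin, nsmul_eq_mul]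
    push_cast
    rw [hm]
    field_simp
    ring
  have hlin : ∑ i : Fin d, (t i.succ - m) • (a i.succ - a 0) = 0 := by
    have h0 : ∑ l, (t l - m) • a l = 0 := by
      simp only [sub_smul, Finset.sum_sub_distrib, ht, ← Finset.smul_sum, hbary, smul_zero,
        sub_zero]
    rw [Fin.sum_univ_succ] at h0
    simp only [smul_sub]
    rw [Finset.sum_sub_distrib, ← Finset.sum_smul, ← h0,
      show t 0 - m = -∑ i : Fin d, (t i.succ - m) by linarith, neg_smul, neg_add_eq_sub]
  have hsucc := Fintype.linearIndependent_iff.1 hnondeg _ hlin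
  have hall : ∀ l, t l = m := by
    intro l
    refine Fin.cases ?_ (fun i => by linarith [hsucc i]) l
    simp only [hsucc, Finset.sum_const_zero] at hsum
    linarith
  rw [hall j, hall k]

lemma exists_isCoordinateSection
    (hnondeg : LinearIndependent ℝ (fun i : Fin d => a i.succ - a 0))
    (hbary : ∑ i, a i = 0) : ∃ σ, IsCoordinateSection a σ := by
  have hspan : Submodule.span ℝ (Set.range a) = ⊤ := by
    rw [eq_top_iff, ← hnondeg.span_eq_top_of_card_eq_finrank' (by simp), Submodule.span_le]
    rintro _ ⟨i, rfl⟩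
    exact sub_mem (Submodule.subset_span ⟨_, rfl⟩) (Submodule.subset_span ⟨_, rfl⟩)
  obtain ⟨σ, hσ⟩ := (Fintype.linearCombination ℝ a).exists_rightInverse_of_surjective
    (by rw [Fintype.range_linearCombination, hspan])
  have hsec : ∀ z, ∑ k, σ z k • a k = z := fun z => by
    simpa [Fintype.linearCombination_apply] using LinearMap.congr_fun hσ z
  refine ⟨σ.toContinuousLinearMap, hsec, fun t j k => ?_⟩
  have := eq_of_sum_smul_eq_zero hnondeg hbary
    (t := fun l => σ (∑ l, t l • a l) l - t l)
    (by simp only [sub_smul, Finset.sum_sub_distrib, hsec, sub_self]) j k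
  simp only [LinearMap.coe_toContinuousLinearMap']
  linarith

lemma isCompact_zonotope (a : Fin (d + 1) → EuclideanSpace ℝ (Fin d)) :
    IsCompact (zonotope a) := by
  have h : IsCompact (Set.univ.pi fun _ : Fin (d + 1) => Set.Icc (0 : ℝ) 1) :=
    isCompact_univ_pi fun _ => isCompact_Icc
  convert h.image (f := fun t => ∑ k, t k • a k) (by fun_prop) using 1
  ext z
  simp only [zonotope, Set.mem_ofPred_eq, Set.mem_image, Set.mem_univ_pi, eq_comm]

lemma sum_smul_eq_of_sub_eq (hbary : ∑ i, a i = 0) {t u : Fin (d + 1) → ℝ}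
    (h : ∀ j k, t j - t k = u j - u k) : ∑ k, t k • a k = ∑ k, u k • a k := by
  have hk : ∀ k, t k = u k + (t 0 - u 0) := fun k => by linarith [h k 0]
  rw [Finset.sum_congr rfl fun k _ => by rw [hk k, add_smul], Finset.sum_add_distrib,
    ← Finset.smul_sum, hbary, smul_zero, add_zero]

variable {σ : EuclideanSpace ℝ (Fin d) →L[ℝ] (Fin (d + 1) → ℝ)}

namespace IsCoordinateSection

lemma mem_zonotope_iff (hσ : IsCoordinateSection a σ) (hbary : ∑ i, a i = 0)
    {z : EuclideanSpace ℝ (Fin d)} :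
    z ∈ zonotope a ↔ ∀ j k, σ z j - σ z k ≤ 1 := by
  constructor
  · rintro ⟨t, ht, rfl⟩ j k
    rw [hσ.apply_sub_apply]
    linarith [(ht j).2, (ht k).1]
  · intro h
    refine ⟨maxNormalize (σ z), fun k => ⟨?_, maxNormalize_le_one _ k⟩, ?_⟩
    · obtain ⟨j, -, hj⟩ := exists_forall_maxNormalize_eq (σ z)
      linarith [hj k, h j k]
    · conv_lhs => rw [← hσ.sum_smul z]
      exact sum_smul_eq_of_sub_eq hbary fun j k => by simp only [maxNormalize]; ring

lemma maxNormalize_nonneg (hσ : IsCoordinateSection a σ) (hbary : ∑ i, a i = 0)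
    {z : EuclideanSpace ℝ (Fin d)} (hz : z ∈ zonotope a) (k : Fin (d + 1)) :
    0 ≤ maxNormalize (σ z) k := by
  obtain ⟨j, -, hj⟩ := exists_forall_maxNormalize_eq (σ z)
  linarith [hj k, (hσ.mem_zonotope_iff hbary).1 hz j k]

lemma mem_translate_coneFace_iff (hσ : IsCoordinateSection a σ) (hbary : ∑ i, a i = 0)
    {x z : EuclideanSpace ℝ (Fin d)} {i : Fin (d + 1)} :
    z ∈ (x + ·) '' coneFace a i ↔ ∀ k, σ x k - σ x i ≤ σ z k - σ z i := by
  constructor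
  · rintro ⟨_, ⟨t, ht, hti, rfl⟩, rfl⟩ k
    have := hσ.apply_sub_apply t k i
    simp only [map_add, Pi.add_apply]
    linarith [ht k]
  · intro h
    refine ⟨z - x, ⟨fun k => σ (z - x) k - σ (z - x) i, fun k => ?_, by simp, ?_⟩,
      add_sub_cancel x z⟩
    · simp only [map_sub, Pi.sub_apply]
      linarith [h k]
    · conv_lhs => rw [← hσ.sum_smul (z - x)]
      exact sum_smul_eq_of_sub_eq hbary fun j k => by ring

lemma apply_sub_apply_lt_one (hσ : IsCoordinateSection a σ) (hbary : ∑ i, a i = 0)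
    {z : EuclideanSpace ℝ (Fin d)} (hz : z ∈ interior (zonotope a)) (j k : Fin (d + 1)) :
    σ z j - σ z k < 1 := by
  rcases eq_or_ne j k with rfl | hjk
  · simp
  have hcont : Filter.Tendsto (fun ε : ℝ => z + ε • a j) (nhdsWithin 0 (Set.Ioi 0)) (nhds z) := by
    have : Continuous fun ε : ℝ => z + ε • a j := by fun_prop
    simpa using (this.tendsto 0).mono_left nhdsWithin_le_nhds
  obtain ⟨ε, hε, hpos⟩ :=
    ((hcont.eventually (mem_interior_iff_mem_nhds.1 hz)).and self_mem_nhdsWithin).exists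
  have hle := (hσ.mem_zonotope_iff hbary).1 hε j k
  have hdir := hσ.apply_sub_apply (Pi.single j 1) j k
  simp only [Pi.single_apply, ite_smul, one_smul, zero_smul, Finset.sum_ite_eq',
    Finset.mem_univ, if_true, hjk.symm, if_false] at hdir
  simp only [map_add, map_smul, Pi.add_apply, Pi.smul_apply, smul_eq_mul] at hle
  have : ε * σ (a j) j - ε * σ (a j) k = ε := by rw [← mul_sub, hdir]; ring
  have : 0 < ε := hpos
  linarith

/-- The facet direction `i` illuminates `x` exactly when the `i`-th normalized coordinate of `x`
is positive. -/
lemma illuminates_iff (hσ : IsCoordinateSection a σ) (hbary : ∑ i, a i = 0)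
    {x : EuclideanSpace ℝ (Fin d)} {i : Fin (d + 1)} :
    (interior ((x + ·) '' coneFace a i) ∩ interior (zonotope a)).Nonempty ↔
      0 < maxNormalize (σ x) i := by
  obtain ⟨m, hm, hmax⟩ := exists_forall_maxNormalize_eq (σ x)
  rw [hmax i]
  constructor
  · rintro ⟨y, hy, hyR⟩
    have h₁ := (hσ.mem_translate_coneFace_iff hbary).1 (interior_subset hy) m
    have h₂ := hσ.apply_sub_apply_lt_one hbary hyR m i
    linarith
  · intro hpos
    set ε : ℝ := (σ x i - σ x m + 1) / 2 with hε
    set w : Fin (d + 1) → ℝ := fun k => if k = i then σ x i else σ x m + ε with hw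
    have hwd := hσ.apply_sub_apply w
    have hcoord : ∀ k, Continuous fun z => σ z k := fun k =>
      (continuous_apply k).comp σ.continuous
    refine ⟨∑ k, w k • a k, mem_interior.2
      ⟨{z | ∀ k, k ≠ i → σ x k - σ x i < σ z k - σ z i}, fun z hz => ?_, ?_, fun k hk => ?_⟩,
      mem_interior.2 ⟨{z | ∀ j k, σ z j - σ z k < 1}, fun z hz => ?_, ?_, fun j k => ?_⟩⟩
    · refine (hσ.mem_translate_coneFace_iff hbary).2 fun k => ?_
      rcases eq_or_ne k i with rfl | hk
      · simp
      · exact (hz k hk).le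
    · simp only [Set.ofPred_forall]
      exact isOpen_iInter_of_finite fun k => isOpen_iInter_of_finite fun _ =>
        isOpen_lt continuous_const ((hcoord k).sub (hcoord i))
    · rw [hwd]
      simp only [hw, hk, if_true, if_false]
      linarith [hm k]
    · exact (hσ.mem_zonotope_iff hbary).2 fun j k => (hz j k).le
    · simp only [Set.ofPred_forall]
      exact isOpen_iInter_of_finite fun j => isOpen_iInter_of_finite fun k =>
        isOpen_lt ((hcoord j).sub (hcoord k)) continuous_const
    · rw [hwd]
      simp only [hw]
      split_ifs <;> linarith [hm i]

lemma aRel_iff (hσ : IsCoordinateSection a σ) (hbary : ∑ i, a i = 0) {S : Type*}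
    {p q : ↥(zonotope a) × (Fin (d + 1) → S)} :
    ARel a S p q ↔
      p.1 = q.1 ∧ ∀ i, 0 < maxNormalize (σ (p.1 : EuclideanSpace ℝ (Fin d))) i → p.2 i = q.2 i := by
  simp only [ARel, hσ.illuminates_iff hbary]

lemma maxNormalize_injective (hσ : IsCoordinateSection a σ) (hbary : ∑ i, a i = 0)
    {x y : EuclideanSpace ℝ (Fin d)} (h : maxNormalize (σ x) = maxNormalize (σ y)) : x = y := by
  rw [← hσ.sum_smul x, ← hσ.sum_smul y]
  refine sum_smul_eq_of_sub_eq hbary fun j k => ?_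
  have hj := congrFun h j
  have hk := congrFun h k
  simp only [maxNormalize] at hj hk
  linarith

end IsCoordinateSection

end

/-- The point of the join with barycentric coordinates proportional to `u` and colors `f`. -/
def JoinSpace.ofWeights {n : ℕ} {S : Type*} [Fintype S] (u : Fin n → ℝ) (hu : ∀ i, 0 ≤ u i)
    (hpos : 0 < ∑ i, u i) (f : Fin n → S) : JoinSpace n S := by
  classical
  refine ⟨fun p => if f p.1 = p.2 then u p.1 / ∑ i, u i else 0, fun p => ?_, ?_, ?_⟩
  · dsimp only
    split_ifs
    exacts [div_nonneg (hu _) hpos.le, le_rfl]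
  · rw [Fintype.sum_prod_type]
    simp [← Finset.sum_div, hpos.ne']
  · intro i s s' hs hs'
    by_contra hne
    dsimp only at hs hs'
    split_ifs at hs hs' <;> simp_all

open Classical in
lemma JoinSpace.ofWeights_apply {n : ℕ} {S : Type*} [Fintype S] {u : Fin n → ℝ}
    (hu : ∀ i, 0 ≤ u i) (hpos : 0 < ∑ i, u i) (f : Fin n → S) (i : Fin n) (s : S) :
    (JoinSpace.ofWeights u hu hpos f).1 (i, s) = if f i = s then u i / ∑ j, u j else 0 :=
  rfl

lemma JoinSpace.sum_ofWeights {n : ℕ} {S : Type*} [Fintype S] {u : Fin n → ℝ}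
    (hu : ∀ i, 0 ≤ u i) (hpos : 0 < ∑ i, u i) (f : Fin n → S) (i : Fin n) :
    ∑ s, (JoinSpace.ofWeights u hu hpos f).1 (i, s) = u i / ∑ j, u j := by
  classical
  simp [JoinSpace.ofWeights_apply]

/-- Every point of the join is given by weights with largest coordinate `1`. -/
lemma JoinSpace.exists_maxNormalize {n : ℕ} {S : Type*} [Fintype S] [Nonempty S]
    (β : JoinSpace (n + 1) S) :
    ∃ (t : Fin (n + 1) → ℝ) (ht : ∀ i, 0 ≤ maxNormalize t i) (f : Fin (n + 1) → S),
      JoinSpace.ofWeights (maxNormalize t) ht (sum_maxNormalize_pos ht) f = β := by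
  classical
  obtain ⟨β, h0, h1, hβ⟩ := β
  set b : Fin (n + 1) → ℝ := fun i => ∑ s, β (i, s)
  have hb0 : ∀ i, 0 ≤ b i := fun i => Finset.sum_nonneg fun s _ => h0 _
  have hb1 : ∑ i, b i = 1 := by rw [← h1, Fintype.sum_prod_type]
  obtain ⟨m, hm, -⟩ := exists_forall_maxNormalize_eq b
  have hbm : 0 < b m := by
    by_contra hneg
    have : ∑ i, b i ≤ 0 := Finset.sum_nonpos fun i _ => (hm i).trans (not_lt.1 hneg)
    linarith
  have hf : ∀ i, ∃ s, ∀ s', s ≠ s' → β (i, s') = 0 := by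
    intro i
    by_cases h : ∃ s, 0 < β (i, s)
    · obtain ⟨s, hs⟩ := h
      exact ⟨s, fun s' hne => le_antisymm (not_lt.1 fun hs' => hne (hβ i s s' hs hs')) (h0 _)⟩
    · push Not at h
      exact ⟨Classical.arbitrary S, fun s' _ => le_antisymm (h s') (h0 _)⟩
  choose f hf using hf
  have hbf : ∀ i, b i = β (i, f i) := fun i =>
    Finset.sum_eq_single_of_mem _ (Finset.mem_univ _) fun s _ hs => hf i s hs.symm
  have ht : maxNormalize (fun i => b i / b m) = fun i => b i / b m := by
    obtain ⟨j, hj, hnorm⟩ := exists_forall_maxNormalize_eq fun i => b i / b m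
    have hj1 : b j / b m = 1 := by
      refine le_antisymm ((div_le_one hbm).2 (hm j)) ?_
      simpa [hbm.ne'] using hj m
    funext i
    rw [hnorm i]
    linarith
  refine ⟨fun i => b i / b m, fun i => ?_, f, Subtype.ext ?_⟩
  · rw [ht]
    exact div_nonneg (hb0 i) hbm.le
  · ext ⟨i, s⟩
    rw [JoinSpace.ofWeights_apply]
    simp only [ht, ← Finset.sum_div, hb1]
    split_ifs with hs
    · rw [div_div_div_cancel_right₀ hbm.ne', div_one, hbf, hs]
    · exact (hf i s hs).symm

lemma maxNormalize_eq_of_div_sum_eq {n : ℕ} {t u : Fin (n + 1) → ℝ}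
    (ht : ∀ k, 0 ≤ maxNormalize t k) (hu : ∀ k, 0 ≤ maxNormalize u k)
    (h : ∀ k, maxNormalize t k / ∑ j, maxNormalize t j =
      maxNormalize u k / ∑ j, maxNormalize u j) :
    maxNormalize t = maxNormalize u := by
  have hT := sum_maxNormalize_pos ht
  have hU := sum_maxNormalize_pos hu
  set T := ∑ j, maxNormalize t j
  set U := ∑ j, maxNormalize u j
  have hmul : ∀ k, maxNormalize t k * U = maxNormalize u k * T := fun k =>
    (div_eq_div_iff hT.ne' hU.ne').1 (h k)
  obtain ⟨i, -, hi⟩ := exists_forall_maxNormalize_eq t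
  obtain ⟨j, -, hj⟩ := exists_forall_maxNormalize_eq u
  have hi1 : maxNormalize t i = 1 := by simp [hi i]
  have hj1 : maxNormalize u j = 1 := by simp [hj j]
  have hUT : U = T := by
    refine le_antisymm ?_ ?_
    · nlinarith [hmul i, maxNormalize_le_one u i]
    · nlinarith [hmul j, maxNormalize_le_one t j]
  funext k
  exact mul_right_cancel₀ hU.ne' ((hmul k).trans (by rw [hUT]))

/-- **Structure of the illumination complex of the Δ-zonotope.** For a
non-degenerate simplex `Δ ⊂ ℝ^d` with barycenter at the origin and a finite
non-empty color set `S`, the illumination complex `A(R_Δ, F_Δ, S)` is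
homeomorphic to the geometric realization of the join `S^{*(d+1)}`, and the
homeomorphism can be chosen equivariantly with respect to every permutation `π`
of `S`, acting by `(x, f) ↦ (x, π ∘ f)` on `A(R_Δ, F_Δ, S)` and by permuting the
`S`-coordinates, `β (i, s) ↦ β (i, π⁻¹ s)`, on `J(d+1, S)`. -/
theorem AComplex_homeomorphic_join_equivariant (d : ℕ)
    (a : Fin (d + 1) → EuclideanSpace ℝ (Fin d))
    (hnondeg : LinearIndependent ℝ (fun i : Fin d => a i.succ - a 0))
    (hbary : ∑ i, a i = 0)
    (S : Type) [Fintype S] [Nonempty S] [TopologicalSpace S] [DiscreteTopology S] :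
    ∃ h : AComplex a S ≃ₜ JoinSpace (d + 1) S,
      ∀ (π : Equiv.Perm S) (x : ↥(zonotope a))
        (f : Fin (d + 1) → S) (i : Fin (d + 1)) (s : S),
        (h (Quot.mk (ARel a S) (x, π ∘ f))).1 (i, s) =
          (h (Quot.mk (ARel a S) (x, f))).1 (i, π.symm s) := by
  classical
  obtain ⟨σ, hσ⟩ := exists_isCoordinateSection hnondeg hbary
  have hnn : ∀ (x : ↥(zonotope a)) k, 0 ≤ maxNormalize (σ x.1) k := fun x =>
    hσ.maxNormalize_nonneg hbary x.2
  set φ : ↥(zonotope a) × (Fin (d + 1) → S) → JoinSpace (d + 1) S := fun p =>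
    JoinSpace.ofWeights (maxNormalize (σ p.1.1)) (hnn p.1) (sum_maxNormalize_pos (hnn p.1)) p.2
  have hφ_apply : ∀ p i s, (φ p).1 (i, s) = if p.2 i = s then
      maxNormalize (σ p.1.1) i / ∑ j, maxNormalize (σ p.1.1) j else 0 :=
    fun p i s => JoinSpace.ofWeights_apply _ _ _ i s
  have hφ_cont : Continuous φ := by
    refine Continuous.subtype_mk (continuous_pi fun ⟨i, s⟩ => ?_) _
    have hcoord : ∀ k, Continuous fun p : ↥(zonotope a) × (Fin (d + 1) → S) =>
        maxNormalize (σ p.1.1) k := fun k =>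
      (continuous_apply k).comp (continuous_maxNormalize.comp
        (σ.continuous.comp (continuous_subtype_val.comp continuous_fst)))
    have hclopen : IsClopen {p : ↥(zonotope a) × (Fin (d + 1) → S) | p.2 i = s} :=
      (isClopen_discrete {s}).preimage ((continuous_apply i).comp continuous_snd)
    refine continuous_if (fun p hp => ?_) (Continuous.continuousOn ?_) continuousOn_const
    · rw [hclopen.frontier_eq] at hp
      exact hp.elim
    · exact (hcoord i).div (continuous_finsetSum _ fun j _ => hcoord j)
        fun p => (sum_maxNormalize_pos (hnn p.1)).ne'
  have hφ_rel : ∀ p q, ARel a S p q → φ p = φ q := by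
    rintro ⟨x, f⟩ ⟨y, g⟩ hpq
    obtain ⟨rfl, hfg⟩ := (hσ.aRel_iff hbary).1 hpq
    refine Subtype.ext (funext fun ⟨i, s⟩ => ?_)
    rw [hφ_apply, hφ_apply]
    rcases (hnn x i).eq_or_lt with h0 | hpos
    · simp [← h0]
    · rw [hfg i hpos]
  have hφ_inj : ∀ p q, φ p = φ q → ARel a S p q := by
    rintro ⟨x, f⟩ ⟨y, g⟩ hpq
    have hxy : maxNormalize (σ x.1) = maxNormalize (σ y.1) := by
      refine maxNormalize_eq_of_div_sum_eq (hnn x) (hnn y) fun k => ?_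
      rw [← JoinSpace.sum_ofWeights (hnn x) (sum_maxNormalize_pos (hnn x)) f k,
        ← JoinSpace.sum_ofWeights (hnn y) (sum_maxNormalize_pos (hnn y)) g k]
      exact Finset.sum_congr rfl fun s _ => congrArg (fun β => β.1 (k, s)) hpq
    refine (hσ.aRel_iff hbary).2
      ⟨Subtype.ext (hσ.maxNormalize_injective hbary hxy), fun i hi => ?_⟩
    by_contra hne
    have h := congrArg (fun β => β.1 (i, f i)) hpq
    simp only [hφ_apply, if_true, if_neg (Ne.symm hne)] at h
    exact (div_pos hi (sum_maxNormalize_pos (hnn x))).ne' h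
  have hφ_surj : Function.Surjective φ := by
    intro β
    obtain ⟨t, ht, f, rfl⟩ := β.exists_maxNormalize
    have hz : maxNormalize (σ (∑ k, maxNormalize t k • a k)) = maxNormalize t :=
      maxNormalize_congr fun j k => by
        rw [hσ.apply_sub_apply, maxNormalize, maxNormalize]
        ring
    refine ⟨(⟨_, maxNormalize t, fun k => ⟨ht k, maxNormalize_le_one t k⟩, rfl⟩, f), ?_⟩
    refine Subtype.ext (funext fun ⟨i, s⟩ => ?_)
    rw [hφ_apply, JoinSpace.ofWeights_apply]
    simp only [hz]
  have : CompactSpace ↥(zonotope a) := isCompact_iff_compactSpace.1 (isCompact_zonotope a)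
  have hbij : Function.Bijective (Quot.lift φ hφ_rel) := by
    refine ⟨?_, fun β => ?_⟩
    · rintro ⟨p⟩ ⟨q⟩ hpq
      exact Quot.sound (hφ_inj p q hpq)
    · obtain ⟨p, hp⟩ := hφ_surj β
      exact ⟨Quot.mk _ p, hp⟩
  refine ⟨Continuous.homeoOfEquivCompactToT2 (f := Equiv.ofBijective _ hbij)
    (continuous_quot_lift hφ_rel hφ_cont), fun π x f i s => ?_⟩
  change (φ (x, π ∘ f)).1 (i, s) = (φ (x, f)).1 (i, π.symm s)
  simp only [hφ_apply, Function.comp_apply, Equiv.eq_symm_apply]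
end
end

section
/- Let Δ = conv{a_0,…,a_d} ⊂ ℝ^d be a non-degenerate simplex with barycenter at the origin and let R_Δ be the associated Δ-zonotope. Then the illumination complex A(R_Δ, F_Δ, {0,1}) with the two-element color set is homeomorphic to the d-dimensional sphere S^d (the unit sphere in ℝ^{d+1}). -/
noncomputable section

open Set Topology

/-- The linear map `t ↦ ∑ k, t k • a k` sending a coefficient vector to the corresponding
combination of the vertices. -/
def vertexCombination {d : ℕ} (a : Fin (d + 1) → EuclideanSpace ℝ (Fin d)) :
    (Fin (d + 1) → ℝ) →ₗ[ℝ] EuclideanSpace ℝ (Fin d) :=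
  Fintype.linearCombination ℝ a

theorem vertexCombination_apply {d : ℕ} (a : Fin (d + 1) → EuclideanSpace ℝ (Fin d))
    (t : Fin (d + 1) → ℝ) : vertexCombination a t = ∑ k, t k • a k :=
  Fintype.linearCombination_apply ℝ a t

theorem continuous_vertexCombination {d : ℕ} (a : Fin (d + 1) → EuclideanSpace ℝ (Fin d)) :
    Continuous (vertexCombination a) :=
  (vertexCombination a).continuous_of_finiteDimensional

theorem vertexCombination_const {d : ℕ} {a : Fin (d + 1) → EuclideanSpace ℝ (Fin d)}
    (hbary : ∑ i, a i = 0) (c : ℝ) : vertexCombination a (fun _ => c) = 0 := by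
  rw [vertexCombination_apply, ← Finset.smul_sum, hbary, smul_zero]

theorem vertexCombination_surjective {d : ℕ} {a : Fin (d + 1) → EuclideanSpace ℝ (Fin d)}
    (hnondeg : LinearIndependent ℝ (fun i : Fin d => a i.succ - a 0)) :
    Function.Surjective (vertexCombination a) := by
  rw [← LinearMap.range_eq_top, eq_top_iff,
    ← hnondeg.span_eq_top_of_card_eq_finrank' (by simp), Submodule.span_le]
  rintro _ ⟨i, rfl⟩
  refine ⟨Pi.single i.succ 1 - Pi.single 0 1, ?_⟩
  simp [vertexCombination]

/-- The coefficients of a linear relation between the vertices are all equal. -/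
theorem eq_of_vertexCombination_eq_zero {d : ℕ} {a : Fin (d + 1) → EuclideanSpace ℝ (Fin d)}
    (hnondeg : LinearIndependent ℝ (fun i : Fin d => a i.succ - a 0)) (hbary : ∑ i, a i = 0)
    {t : Fin (d + 1) → ℝ} (ht : vertexCombination a t = 0) (i j : Fin (d + 1)) : t i = t j := by
  obtain ⟨m, hm⟩ : ∃ m : ℝ, ∑ k, (t k - m) = 0 := by
    refine ⟨(∑ k, t k) / (d + 1), ?_⟩
    simp only [Finset.sum_sub_distrib, Finset.sum_const, Finset.card_univ, Fintype.card_fin,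
      nsmul_eq_mul]
    push_cast
    field_simp
    simp
  have hsum : ∑ k, (t k - m) • (a k - a 0) = 0 := by
    simp only [smul_sub, Finset.sum_sub_distrib, ← Finset.sum_smul, hm, zero_smul, sub_zero]
    simp only [sub_smul, Finset.sum_sub_distrib, ← Finset.smul_sum, hbary, smul_zero, sub_zero]
    rwa [vertexCombination_apply] at ht
  rw [Fin.sum_univ_succ, sub_self, smul_zero, zero_add] at hsum
  have hsucc := Fintype.linearIndependent_iff.1 hnondeg (fun i => t i.succ - m) hsum
  rw [Fin.sum_univ_succ, Finset.sum_eq_zero (fun i _ => hsucc i), add_zero] at hm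
  have hall : ∀ k, t k - m = 0 := Fin.cases hm hsucc
  linarith [hall i, hall j]

/-- The points of the unit cube having some coordinate equal to `1`. -/
def upperCubeBoundary (d : ℕ) : Set (Fin (d + 1) → ℝ) :=
  {t | (∀ k, t k ∈ Icc (0 : ℝ) 1) ∧ ∃ k, t k = 1}

theorem isCompact_upperCubeBoundary (d : ℕ) : IsCompact (upperCubeBoundary d) := by
  have hcube : IsCompact (univ.pi fun _ : Fin (d + 1) => Icc (0 : ℝ) 1) :=
    isCompact_univ_pi fun _ => isCompact_Icc
  have hclosed : IsClosed (⋃ k : Fin (d + 1), {t : Fin (d + 1) → ℝ | t k = 1}) :=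
    isClosed_iUnion_of_finite fun k => isClosed_eq (continuous_apply k) continuous_const
  convert hcube.inter_right hclosed using 1
  ext t
  simp [upperCubeBoundary, mem_pi, -pi_univ_Icc]

/-- Points of the zonotope have unique coefficients in the upper boundary of the cube. -/
theorem bijOn_vertexCombination {d : ℕ} {a : Fin (d + 1) → EuclideanSpace ℝ (Fin d)}
    (hnondeg : LinearIndependent ℝ (fun i : Fin d => a i.succ - a 0)) (hbary : ∑ i, a i = 0) :
    BijOn (vertexCombination a) (upperCubeBoundary d) (zonotope a) := by
  refine ⟨fun t ht => ⟨t, ht.1, vertexCombination_apply a t⟩, ?_, ?_⟩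
  · intro t ht s hs hts
    have hconst := fun i j => eq_of_vertexCombination_eq_zero hnondeg hbary
      (t := t - s) (by rw [map_sub, hts, sub_self]) i j
    simp only [Pi.sub_apply] at hconst
    obtain ⟨k, hk⟩ := ht.2
    obtain ⟨l, hl⟩ := hs.2
    ext i
    linarith [hconst i k, hconst i l, (hs.1 k).2, (ht.1 l).2]
  · rintro _ ⟨t, ht, rfl⟩
    obtain ⟨k, hk⟩ := Finite.exists_max t
    refine ⟨t + fun _ => 1 - t k, ⟨fun i => ?_, k, by simp⟩, ?_⟩
    · have := hk i
      have := (ht i).1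
      have := (ht k).2
      simp only [Pi.add_apply, mem_Icc]
      constructor <;> linarith
    · rw [map_add, vertexCombination_const hbary, add_zero, vertexCombination_apply]

/-- The homeomorphism between the upper boundary of the cube and the zonotope. -/
def zonotopeHomeomorph {d : ℕ} {a : Fin (d + 1) → EuclideanSpace ℝ (Fin d)}
    (hnondeg : LinearIndependent ℝ (fun i : Fin d => a i.succ - a 0)) (hbary : ∑ i, a i = 0) :
    upperCubeBoundary d ≃ₜ zonotope a :=
  haveI := isCompact_iff_compactSpace.1 (isCompact_upperCubeBoundary d)
  Continuous.homeoOfEquivCompactToT2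
    (f := (bijOn_vertexCombination hnondeg hbary).equiv (vertexCombination a))
    (((continuous_vertexCombination a).comp continuous_subtype_val).subtype_mk _)

theorem coe_zonotopeHomeomorph {d : ℕ} {a : Fin (d + 1) → EuclideanSpace ℝ (Fin d)}
    (hnondeg : LinearIndependent ℝ (fun i : Fin d => a i.succ - a 0)) (hbary : ∑ i, a i = 0)
    (t : upperCubeBoundary d) :
    (zonotopeHomeomorph hnondeg hbary t : EuclideanSpace ℝ (Fin d)) = vertexCombination a t :=
  rfl

/-- Coefficients of points in the interior of the zonotope differ by less than `1`. -/
theorem sub_lt_one_of_mem_interior_zonotope {d : ℕ}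
    {a : Fin (d + 1) → EuclideanSpace ℝ (Fin d)}
    (hnondeg : LinearIndependent ℝ (fun i : Fin d => a i.succ - a 0)) (hbary : ∑ i, a i = 0)
    {s : Fin (d + 1) → ℝ} (hs : vertexCombination a s ∈ interior (zonotope a))
    {i k : Fin (d + 1)} (hik : i ≠ k) : s k - s i < 1 := by
  have hcont : Continuous fun ε : ℝ => vertexCombination a (s + ε • Pi.single k 1) :=
    (continuous_vertexCombination a).comp (by fun_prop)
  have hopen : ∀ᶠ ε in 𝓝 (0 : ℝ),
      vertexCombination a (s + ε • Pi.single k 1) ∈ interior (zonotope a) :=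
    hcont.continuousAt.eventually_mem (isOpen_interior.mem_nhds (by simpa using hs))
  obtain ⟨ε, hε, hpos⟩ :=
    ((hopen.filter_mono nhdsWithin_le_nhds).and (self_mem_nhdsWithin (s := Ioi (0 : ℝ)))).exists
  obtain ⟨r, hr, hsr⟩ := interior_subset hε
  rw [← vertexCombination_apply] at hsr
  have hconst := eq_of_vertexCombination_eq_zero hnondeg hbary
    (t := s + ε • Pi.single k 1 - r) (by rw [map_sub, hsr, sub_self]) i k
  simp [hik] at hconst
  linarith [(hr k).2, (hr i).1, show 0 < ε from hpos]

/-- The translated cone over the facet opposite to vertex `i` meets the interior of the zonotope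
exactly when the `i`-th normalized coefficient of the apex is positive. -/
theorem interior_cone_inter_interior_zonotope_nonempty_iff {d : ℕ}
    {a : Fin (d + 1) → EuclideanSpace ℝ (Fin d)}
    (hnondeg : LinearIndependent ℝ (fun i : Fin d => a i.succ - a 0)) (hbary : ∑ i, a i = 0)
    {t : Fin (d + 1) → ℝ} (ht : t ∈ upperCubeBoundary d) (i : Fin (d + 1)) :
    (interior ((vertexCombination a t + ·) '' coneFace a i) ∩ interior (zonotope a)).Nonempty ↔
      0 < t i := by
  constructor
  · rintro ⟨y, hy, hyz⟩
    by_contra! hti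
    have hti : t i = 0 := le_antisymm hti (ht.1 i).1
    obtain ⟨k, hk⟩ := ht.2
    have hik : i ≠ k := by rintro rfl; linarith
    obtain ⟨_, ⟨c, hc, hci, rfl⟩, rfl⟩ := interior_subset hy
    rw [← vertexCombination_apply] at hyz
    beta_reduce at hyz
    rw [← map_add] at hyz
    have := sub_lt_one_of_mem_interior_zonotope hnondeg hbary hyz hik
    simp only [Pi.add_apply] at this
    linarith [hc k]
  · intro hti
    let U : Set (Fin (d + 1) → ℝ) :=
      (⋂ k ∈ ({i}ᶜ : Set (Fin (d + 1))), {s | t k - t i < s k - s i}) ∩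
        univ.pi fun _ => Ioo (0 : ℝ) 1
    have hU : IsOpen U := by
      refine IsOpen.inter ?_ (isOpen_set_pi finite_univ fun _ _ => isOpen_Ioo)
      exact (toFinite _).isOpen_biInter fun k _ => isOpen_lt (by fun_prop) (by fun_prop)
    have hLU : IsOpen (vertexCombination a '' U) :=
      (vertexCombination a).isOpenMap_of_finiteDimensional
        (vertexCombination_surjective hnondeg) U hU
    have hne : (fun k => if k = i then t i / 2 else 1 - t i / 4) ∈ U := by
      have hti1 := (ht.1 i).2
      refine ⟨?_, fun k _ => ?_⟩
      · simp only [mem_compl_iff, mem_singleton_iff, mem_iInter, mem_ofPred_eq]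
        intro k hk
        simp only [hk, if_false, if_true]
        linarith [(ht.1 k).2]
      · simp only [mem_Ioo]
        split_ifs <;> constructor <;> linarith
    refine ⟨_, interior_maximal ?_ hLU ⟨_, hne, rfl⟩, interior_maximal ?_ hLU ⟨_, hne, rfl⟩⟩
    · rintro _ ⟨s, hs, rfl⟩
      refine ⟨_, ⟨s - t - fun _ => s i - t i, fun k => ?_, by simp,
        (vertexCombination_apply a _)⟩, ?_⟩
      · by_cases hk : k = i
        · simp [hk]
        · have := mem_iInter₂.1 hs.1 k hk
          simp only [mem_ofPred_eq] at this
          simp only [Pi.sub_apply]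
          linarith
      · simp [vertexCombination_const hbary]
    · rintro _ ⟨s, hs, rfl⟩
      exact ⟨s, fun k => Ioo_subset_Icc_self (hs.2 k trivial), vertexCombination_apply a s⟩

/-- The sign attached to a color. -/
def colorSign (c : Fin 2) : ℝ := if c = 0 then 1 else -1

theorem abs_colorSign (c : Fin 2) : |colorSign c| = 1 := by
  unfold colorSign
  split_ifs <;> simp

theorem colorSign_injective : Function.Injective colorSign := by
  intro b c h
  fin_cases b <;> fin_cases c <;> simp [colorSign] at h ⊢ <;> linarith

/-- The point of the boundary of the cube `[-1, 1]^(d+1)` with absolute values `t` and signs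
given by the colors `f`. -/
def signedPoint {d : ℕ} (t : Fin (d + 1) → ℝ) (f : Fin (d + 1) → Fin 2) :
    EuclideanSpace ℝ (Fin (d + 1)) :=
  WithLp.toLp 2 fun i => colorSign (f i) * t i

theorem signedPoint_ne_zero {d : ℕ} {t : Fin (d + 1) → ℝ} (ht : t ∈ upperCubeBoundary d)
    (f : Fin (d + 1) → Fin 2) : signedPoint t f ≠ 0 := by
  obtain ⟨k, hk⟩ := ht.2
  intro h
  have hz : colorSign (f k) * t k = 0 := congrArg (fun v => v.ofLp k) h
  have := abs_colorSign (f k)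
  rw [hk, mul_one] at hz
  simp [hz] at this

theorem abs_signedPoint {d : ℕ} {t : Fin (d + 1) → ℝ} (ht : t ∈ upperCubeBoundary d)
    (f : Fin (d + 1) → Fin 2) (i : Fin (d + 1)) : |signedPoint t f i| = t i := by
  simp [signedPoint, abs_mul, abs_colorSign, abs_of_nonneg (ht.1 i).1]

/-- The radial projection of `signedPoint` to the unit sphere. -/
def signedDirection {d : ℕ} (t : upperCubeBoundary d) (f : Fin (d + 1) → Fin 2) :
    Metric.sphere (0 : EuclideanSpace ℝ (Fin (d + 1))) 1 :=
  ⟨‖signedPoint t.1 f‖⁻¹ • signedPoint t.1 f, by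
    simp [norm_smul, signedPoint_ne_zero t.2 f]⟩

theorem continuous_signedDirection (d : ℕ) :
    Continuous fun p : upperCubeBoundary d × (Fin (d + 1) → Fin 2) =>
      signedDirection p.1 p.2 := by
  have hsign : Continuous colorSign := continuous_of_discreteTopology
  have hpoint : Continuous fun p : upperCubeBoundary d × (Fin (d + 1) → Fin 2) =>
      signedPoint p.1.1 p.2 := by
    refine (PiLp.continuous_toLp 2 _).comp (continuous_pi fun i => ?_)
    exact (hsign.comp (by fun_prop)).mul
      ((continuous_apply i).comp (continuous_subtype_val.comp continuous_fst))
  refine Continuous.subtype_mk ((hpoint.norm.inv₀ fun p => ?_).smul hpoint) _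
  exact norm_ne_zero_iff.2 (signedPoint_ne_zero p.1.2 p.2)

theorem signedDirection_eq_iff {d : ℕ} (t s : upperCubeBoundary d) (f g : Fin (d + 1) → Fin 2) :
    signedDirection t f = signedDirection s g ↔ t = s ∧ ∀ i, 0 < t.1 i → f i = g i := by
  constructor
  · intro h
    have hv : ‖signedPoint t.1 f‖⁻¹ • signedPoint t.1 f =
        ‖signedPoint s.1 g‖⁻¹ • signedPoint s.1 g := congrArg Subtype.val h
    have ht0 : 0 < ‖signedPoint t.1 f‖⁻¹ := inv_pos.2 (norm_pos_iff.2 (signedPoint_ne_zero t.2 f))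
    have hs0 : 0 < ‖signedPoint s.1 g‖⁻¹ := inv_pos.2 (norm_pos_iff.2 (signedPoint_ne_zero s.2 g))
    generalize ‖signedPoint t.1 f‖⁻¹ = b at hv ht0
    generalize ‖signedPoint s.1 g‖⁻¹ = c at hv hs0
    have hcoord : ∀ i, b * signedPoint t.1 f i = c * signedPoint s.1 g i := fun i =>
      congrArg (fun v => v.ofLp i) hv
    have habs : ∀ i, b * t.1 i = c * s.1 i := fun i => by
      have := congrArg abs (hcoord i)
      rwa [abs_mul, abs_mul, abs_signedPoint t.2, abs_signedPoint s.2, abs_of_pos ht0,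
        abs_of_pos hs0] at this
    have hbc : b = c := by
      obtain ⟨k, hk⟩ := t.2.2
      obtain ⟨l, hl⟩ := s.2.2
      have h1 := habs k
      have h2 := habs l
      rw [hk] at h1
      rw [hl] at h2
      nlinarith [(s.2.1 k).2, (t.2.1 l).2]
    subst hbc
    have hts : t = s := Subtype.ext (funext fun i => mul_left_cancel₀ ht0.ne' (habs i))
    subst hts
    refine ⟨rfl, fun i hi => colorSign_injective ?_⟩
    exact mul_right_cancel₀ hi.ne' (mul_left_cancel₀ ht0.ne' (hcoord i))
  · rintro ⟨rfl, hfg⟩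
    have : signedPoint t.1 f = signedPoint t.1 g := by
      ext i
      rcases (t.2.1 i).1.eq_or_lt with hi | hi
      · simp [signedPoint, ← hi]
      · simp [signedPoint, hfg i hi]
    simp [signedDirection, this]

theorem exists_signedDirection_eq {d : ℕ}
    (u : Metric.sphere (0 : EuclideanSpace ℝ (Fin (d + 1))) 1) :
    ∃ (t : upperCubeBoundary d) (f : Fin (d + 1) → Fin 2), signedDirection t f = u := by
  obtain ⟨k, hk⟩ := Finite.exists_max fun i => |u.1 i|
  have hu : ‖u.1‖ = 1 := by simp
  have hpos : 0 < |u.1 k| := by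
    refine (abs_nonneg _).lt_of_ne fun h => ?_
    have : u.1 = 0 := by
      ext i
      exact abs_eq_zero.1 (le_antisymm ((hk i).trans_eq h.symm) (abs_nonneg _))
    simp [this] at hu
  refine ⟨⟨fun i => |u.1 i| / |u.1 k|, fun i => ⟨by positivity, ?_⟩, k, div_self hpos.ne'⟩,
    fun i => if 0 ≤ u.1 i then 0 else 1, Subtype.ext ?_⟩
  · exact (div_le_one hpos).2 (hk i)
  · have : signedPoint (fun i => |u.1 i| / |u.1 k|) (fun i => if 0 ≤ u.1 i then 0 else 1) =
        |u.1 k|⁻¹ • u.1 := by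
      ext i
      by_cases hi : 0 ≤ u.1 i
      · simp [signedPoint, colorSign, hi, abs_of_nonneg hi, div_eq_inv_mul]
      · simp [signedPoint, colorSign, hi, abs_of_neg (not_le.1 hi), div_eq_inv_mul]
    simp only [signedDirection, this, norm_smul, hu, smul_smul]
    simp [hpos.ne']

theorem aRel_iff_signedDirection_eq {d : ℕ} {a : Fin (d + 1) → EuclideanSpace ℝ (Fin d)}
    (hnondeg : LinearIndependent ℝ (fun i : Fin d => a i.succ - a 0)) (hbary : ∑ i, a i = 0)
    (p q : zonotope a × (Fin (d + 1) → Fin 2)) :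
    ARel a (Fin 2) p q ↔
      signedDirection ((zonotopeHomeomorph hnondeg hbary).symm p.1) p.2 =
        signedDirection ((zonotopeHomeomorph hnondeg hbary).symm q.1) q.2 := by
  obtain ⟨x, f⟩ := p
  obtain ⟨t, rfl⟩ := (zonotopeHomeomorph hnondeg hbary).surjective x
  simp only [ARel, signedDirection_eq_iff, coe_zonotopeHomeomorph,
    interior_cone_inter_interior_zonotope_nonempty_iff hnondeg hbary t.2,
    Homeomorph.symm_apply_apply, Homeomorph.eq_symm_apply]

/-- The map from the two-colored illumination complex to the sphere. -/
def AComplex.toSphere {d : ℕ} {a : Fin (d + 1) → EuclideanSpace ℝ (Fin d)}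
    (hnondeg : LinearIndependent ℝ (fun i : Fin d => a i.succ - a 0)) (hbary : ∑ i, a i = 0) :
    AComplex a (Fin 2) → Metric.sphere (0 : EuclideanSpace ℝ (Fin (d + 1))) 1 :=
  Quot.lift (fun p => signedDirection ((zonotopeHomeomorph hnondeg hbary).symm p.1) p.2)
    fun p q h => (aRel_iff_signedDirection_eq hnondeg hbary p q).1 h

theorem AComplex.continuous_toSphere {d : ℕ} {a : Fin (d + 1) → EuclideanSpace ℝ (Fin d)}
    (hnondeg : LinearIndependent ℝ (fun i : Fin d => a i.succ - a 0)) (hbary : ∑ i, a i = 0) :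
    Continuous (toSphere hnondeg hbary) := by
  have hpair : Continuous fun p : zonotope a × (Fin (d + 1) → Fin 2) =>
      ((zonotopeHomeomorph hnondeg hbary).symm p.1, p.2) :=
    ((zonotopeHomeomorph hnondeg hbary).symm.continuous.comp continuous_fst).prodMk
      continuous_snd
  have hdirection := (continuous_signedDirection d).comp hpair
  exact continuous_quot_lift _ hdirection

theorem AComplex.bijective_toSphere {d : ℕ} {a : Fin (d + 1) → EuclideanSpace ℝ (Fin d)}
    (hnondeg : LinearIndependent ℝ (fun i : Fin d => a i.succ - a 0)) (hbary : ∑ i, a i = 0) :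
    Function.Bijective (toSphere hnondeg hbary) := by
  refine ⟨?_, fun u => ?_⟩
  · rintro ⟨p⟩ ⟨q⟩ h
    exact Quot.sound ((aRel_iff_signedDirection_eq hnondeg hbary p q).2 h)
  · obtain ⟨t, f, rfl⟩ := exists_signedDirection_eq u
    exact ⟨Quot.mk _ (zonotopeHomeomorph hnondeg hbary t, f), by simp [toSphere]⟩

/-- For a non-degenerate simplex `Δ ⊂ ℝ^d` with barycenter at the origin, the
illumination complex `A(R_Δ, F_Δ, {0,1})` with two colors is homeomorphic to the
`d`-sphere (the unit sphere in `ℝ^{d+1}`). -/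
theorem AComplex_two_colors_homeomorphic_sphere (d : ℕ)
    (a : Fin (d + 1) → EuclideanSpace ℝ (Fin d))
    (hnondeg : LinearIndependent ℝ (fun i : Fin d => a i.succ - a 0))
    (hbary : ∑ i, a i = 0) :
    Nonempty (AComplex a (Fin 2) ≃ₜ
      (Metric.sphere (0 : EuclideanSpace ℝ (Fin (d + 1))) 1 :
        Set (EuclideanSpace ℝ (Fin (d + 1))))) := by
  have : CompactSpace (upperCubeBoundary d) :=
    isCompact_iff_compactSpace.1 (isCompact_upperCubeBoundary d)
  have : CompactSpace (zonotope a) := (zonotopeHomeomorph hnondeg hbary).compactSpace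
  exact ⟨Continuous.homeoOfEquivCompactToT2
    (f := Equiv.ofBijective _ (AComplex.bijective_toSphere hnondeg hbary))
    (AComplex.continuous_toSphere hnondeg hbary)⟩
end
end

section
/- Injectivity of the illumination-volume map: Let Δ = conv{a_0,…,a_d} ⊂ ℝ^d be a non-degenerate simplex with barycenter at the origin and let R_Δ be the associated Δ-zonotope. Then the map ψ : R_Δ → ℝ^{d+1} defined by ψ(x) = (vol((x + cone(F_0)) ∩ R_Δ), …, vol((x + cone(F_d)) ∩ R_Δ)) is injective. -/
open MeasureTheory

noncomputable section

theorem baryCoord_const {d : ℕ} {a : Fin (d + 1) → EuclideanSpace ℝ (Fin d)}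
    (hnondeg : LinearIndependent ℝ (fun i : Fin d => a i.succ - a 0))
    (hbary : ∑ i, a i = 0) {c : Fin (d + 1) → ℝ} (hc : ∑ k, c k • a k = 0)
    (i j : Fin (d + 1)) : c i = c j := by
  set m : ℝ := (∑ k, c k) / (d + 1) with hm
  have hd : (d + 1 : ℝ) ≠ 0 := by positivity
  have hsum : ∑ k, (c k - m) = 0 := by
    simp only [Finset.sum_sub_distrib, Finset.sum_const, Finset.card_univ, Fintype.card_fin,
      nsmul_eq_mul, hm]
    push_cast
    field_simp
    ring
  have hz : ∑ k, (c k - m) • (a k - a 0) = 0 := by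
    simp only [smul_sub, Finset.sum_sub_distrib, ← Finset.sum_smul, hsum, zero_smul]
    simp only [sub_smul, Finset.sum_sub_distrib, ← Finset.smul_sum, hbary, hc, smul_zero, sub_zero]
  rw [Fin.sum_univ_succ] at hz
  simp only [sub_self, smul_zero, zero_add] at hz
  have hs : ∀ k : Fin d, c k.succ - m = 0 := Fintype.linearIndependent_iff.mp hnondeg _ hz
  have h0 : c 0 - m = 0 := by
    rw [Fin.sum_univ_succ] at hsum
    simpa only [hs, Finset.sum_const_zero, add_zero] using hsum
  have hall : ∀ k, c k - m = 0 := Fin.cases h0 hs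
  linarith [hall i, hall j]

theorem baryCoord_surjective {d : ℕ} {a : Fin (d + 1) → EuclideanSpace ℝ (Fin d)}
    (hnondeg : LinearIndependent ℝ (fun i : Fin d => a i.succ - a 0)) :
    Function.Surjective (Fintype.linearCombination ℝ a) := by
  rw [← LinearMap.range_eq_top, Fintype.range_linearCombination, eq_top_iff,
    ← hnondeg.span_eq_top_of_card_eq_finrank' (by simp), Submodule.span_le]
  rintro _ ⟨i, rfl⟩
  exact sub_mem (Submodule.subset_span ⟨_, rfl⟩) (Submodule.subset_span ⟨_, rfl⟩)

theorem mem_translate_coneFace {d : ℕ} {a : Fin (d + 1) → EuclideanSpace ℝ (Fin d)}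
    (hnondeg : LinearIndependent ℝ (fun i : Fin d => a i.succ - a 0))
    (hbary : ∑ i, a i = 0) (i : Fin (d + 1)) (t y : Fin (d + 1) → ℝ) :
    ∑ k, y k • a k ∈ ((∑ k, t k • a k) + ·) '' coneFace a i ↔
      ∀ k, t k - t i ≤ y k - y i := by
  constructor
  · rintro ⟨_, ⟨c, hc0, hci, rfl⟩, h⟩ k
    have hz : ∑ k, (t k + c k - y k) • a k = 0 := by
      simpa [add_smul, sub_smul, Finset.sum_add_distrib, sub_eq_zero] using h
    linarith [baryCoord_const hnondeg hbary hz k i, hc0 k]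
  · intro h
    refine ⟨_, ⟨fun k => (y k - y i) - (t k - t i), fun k => sub_nonneg.2 (h k),
      by ring, rfl⟩, ?_⟩
    simp only [sub_smul, Finset.sum_sub_distrib, ← Finset.smul_sum, hbary]
    simp

theorem mem_zonotope_iff {d : ℕ} {a : Fin (d + 1) → EuclideanSpace ℝ (Fin d)}
    (hnondeg : LinearIndependent ℝ (fun i : Fin d => a i.succ - a 0))
    (hbary : ∑ i, a i = 0) (y : Fin (d + 1) → ℝ) :
    ∑ k, y k • a k ∈ zonotope a ↔ ∀ k m, y k - y m ≤ 1 := by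
  constructor
  · rintro ⟨t, ht, h⟩ k m
    have hz : ∑ k, (y k - t k) • a k = 0 := by
      simpa [sub_smul, sub_eq_zero] using h
    linarith [baryCoord_const hnondeg hbary hz k m, (ht k).2, (ht m).1]
  · intro h
    obtain ⟨m, hm⟩ := Finite.exists_min y
    refine ⟨fun k => y k - y m, fun k => ⟨sub_nonneg.2 (hm k), h k m⟩, ?_⟩
    simp [sub_smul, Finset.sum_sub_distrib, ← Finset.smul_sum, hbary]

theorem volume_zonotope_ne_top {d : ℕ} (a : Fin (d + 1) → EuclideanSpace ℝ (Fin d)) :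
    volume (zonotope a) ≠ ⊤ := by
  have h : zonotope a =
      Fintype.linearCombination ℝ a '' Set.univ.pi fun _ => Set.Icc (0 : ℝ) 1 := by
    ext z
    simp only [zonotope, Set.mem_ofPred_eq, Set.mem_image, Set.mem_univ_pi,
      Fintype.linearCombination_apply, eq_comm]
  rw [h]
  exact ((isCompact_univ_pi fun _ => isCompact_Icc).image
    (LinearMap.continuous_of_finiteDimensional _)).measure_ne_top

theorem exists_baryCoord_between {ι : Type*} [Finite ι] {t t' : ι → ℝ} {i j : ι}
    (ht : ∀ k m, t k - t m ≤ 1) (hi : ∀ k, t k - t i < 1) (hj : t j - t i < t' j - t' i) :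
    ∃ y : ι → ℝ, (∀ k, k ≠ i → t k - t i < y k - y i) ∧ y j - y i < t' j - t' i ∧
      ∀ k m, y k - y m < 1 := by
  classical
  have small : ∀ δ : ℝ, 0 < δ → ∀ᶠ ε in nhdsWithin (0 : ℝ) (Set.Ioi 0), ε < δ := fun δ hδ =>
    mem_nhdsWithin_of_mem_nhds (Iio_mem_nhds hδ)
  obtain ⟨ε, hε, hε1, hεj, hεi⟩ :=
    (Filter.Eventually.and (eventually_mem_nhdsWithin (a := (0 : ℝ)) (s := Set.Ioi 0)) ((small 1 one_pos).and
    ((small (((t' j - t' i) - (t j - t i)) / 2) (by linarith)).and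
      (Filter.eventually_all.2 fun k => small ((1 - (t k - t i)) / 2)
        (by linarith [hi k]))))).exists
  have hε : 0 < ε := hε
  have hji : j ≠ i := by rintro rfl; simp at hj
  refine ⟨fun k => if k = i then 0 else (1 - ε / 2) * (t k - t i) + ε, ?_, ?_, ?_⟩
  · intro k hk
    simp only [hk, if_true, if_false]
    nlinarith [hi k]
  · simp only [hji, if_true, if_false]
    nlinarith [ht i j]
  · intro k m
    by_cases hk : k = i <;> by_cases hm : m = i <;> simp only [hk, hm, if_true, if_false]
    · norm_num
    · nlinarith [ht i m]
    · nlinarith [ht i k, hεi k]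
    · nlinarith [ht k m]

theorem volume_illuminated_lt {d : ℕ} {a : Fin (d + 1) → EuclideanSpace ℝ (Fin d)}
    (hnondeg : LinearIndependent ℝ (fun i : Fin d => a i.succ - a 0))
    (hbary : ∑ i, a i = 0) {t t' : Fin (d + 1) → ℝ} {i j : Fin (d + 1)}
    (ht : ∀ k m, t k - t m ≤ 1) (hi : ∀ k, t k - t i < 1)
    (hle : ∀ k, t k - t i ≤ t' k - t' i) (hj : t j - t i < t' j - t' i) :
    volume (((∑ k, t' k • a k) + ·) '' coneFace a i ∩ zonotope a) <
      volume (((∑ k, t k • a k) + ·) '' coneFace a i ∩ zonotope a) := by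
  set W : Set (Fin (d + 1) → ℝ) := {y | (∀ k, k ≠ i → t k - t i < y k - y i) ∧
    y j - y i < t' j - t' i ∧ ∀ k m, y k - y m < 1} with hW
  have hWo : IsOpen W := by
    simp only [hW, Set.ofPred_and, Set.ofPred_forall]
    refine IsOpen.inter (isOpen_iInter_of_finite fun k => isOpen_iInter_of_finite fun _ =>
      isOpen_lt (by fun_prop) (by fun_prop)) (IsOpen.inter (isOpen_lt (by fun_prop) (by fun_prop))
      (isOpen_iInter_of_finite fun k => isOpen_iInter_of_finite fun m =>
        isOpen_lt (by fun_prop) (by fun_prop)))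
  have hWne : W.Nonempty := exists_baryCoord_between ht hi hj
  set U := Fintype.linearCombination ℝ a '' W with hU
  have hUo : IsOpen U :=
    LinearMap.isOpenMap_of_finiteDimensional _ (baryCoord_surjective hnondeg) _ hWo
  have hpos : 0 < volume U := hUo.measure_pos _ (hWne.image _)
  set B := ((∑ k, t' k • a k) + ·) '' coneFace a i ∩ zonotope a with hB
  have hBfin : volume B ≠ ⊤ :=
    measure_ne_top_of_subset Set.inter_subset_right (volume_zonotope_ne_top a)
  have hdisj : Disjoint B U := by
    rw [Set.disjoint_left]
    rintro _ ⟨hb, -⟩ ⟨y, hy, rfl⟩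
    rw [Fintype.linearCombination_apply, mem_translate_coneFace hnondeg hbary] at hb
    linarith [hb j, hy.2.1]
  calc volume B < volume B + volume U := ENNReal.lt_add_right hBfin hpos.ne'
    _ = volume (B ∪ U) := (measure_union hdisj hUo.measurableSet).symm
    _ ≤ _ := measure_mono (Set.union_subset ?_ ?_)
  · rintro z ⟨hz, hzR⟩
    refine ⟨?_, hzR⟩
    obtain ⟨y, rfl⟩ := baryCoord_surjective hnondeg z
    rw [Fintype.linearCombination_apply, mem_translate_coneFace hnondeg hbary] at hz ⊢
    exact fun k => (hle k).trans (hz k)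
  · rintro _ ⟨y, hy, rfl⟩
    rw [Fintype.linearCombination_apply]
    refine ⟨(mem_translate_coneFace hnondeg hbary _ _ _).2 fun k => ?_,
      (mem_zonotope_iff hnondeg hbary _).2 fun k m => (hy.2.2 k m).le⟩
    rcases eq_or_ne k i with rfl | hk
    · simp
    · exact (hy.1 k hk).le

/-- **Injectivity of the illumination-volume map.** For a non-degenerate simplex
`Δ ⊂ ℝ^d` with barycenter at the origin, the map `ψ : R_Δ → ℝ^{d+1}` given by
`ψ(x) i = vol ((x + cone (F i)) ∩ R_Δ)` is injective on the Δ-zonotope `R_Δ`. -/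
theorem illumination_volume_map_injective (d : ℕ)
    (a : Fin (d + 1) → EuclideanSpace ℝ (Fin d))
    (hnondeg : LinearIndependent ℝ (fun i : Fin d => a i.succ - a 0))
    (hbary : ∑ i, a i = 0) :
    Set.InjOn
      (fun x : EuclideanSpace ℝ (Fin d) =>
        fun i : Fin (d + 1) => volume ((x + ·) '' coneFace a i ∩ zonotope a))
      (zonotope a) := by
  rintro _ ⟨t, ht, rfl⟩ _ ⟨t', ht', rfl⟩ hvol
  have spread : ∀ {s : Fin (d + 1) → ℝ}, (∀ k, s k ∈ Set.Icc (0 : ℝ) 1) →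
      ∀ k m, s k - s m ≤ 1 := fun hs k m => by linarith [(hs k).2, (hs m).1]
  obtain ⟨i, hi⟩ := Finite.exists_min (t' - t)
  obtain ⟨j, hj⟩ := Finite.exists_max (t' - t)
  simp only [Pi.sub_apply] at hi hj
  rcases (hi j).eq_or_lt with hij | hij
  · have hconst : ∀ k, t' k = t k + (t' i - t i) := fun k => by linarith [hi k, hj k]
    generalize t' i - t i = c at hconst
    simp_rw [hconst]
    simp only [add_smul, Finset.sum_add_distrib, ← Finset.smul_sum, hbary, smul_zero, add_zero]
  · obtain ⟨p, hp⟩ : ∃ p, 1 ≤ t p - t i := by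
      by_contra! h
      exact (volume_illuminated_lt hnondeg hbary (j := j) (spread ht) h
        (fun k => by linarith [hi k]) (by linarith)).ne' (congrFun hvol i)
    obtain ⟨q, hq⟩ : ∃ q, 1 ≤ t' q - t' j := by
      by_contra! h
      exact (volume_illuminated_lt hnondeg hbary (j := i) (spread ht') h
        (fun k => by linarith [hj k]) (by linarith)).ne (congrFun hvol j)
    linarith [spread ht p j, spread ht' q i]
end
end

section
/- Strict monotonicity of illuminated volumes: Let Δ = conv{a_0,…,a_d} ⊂ ℝ^d be a non-degenerate simplex with barycenter at the origin and R_Δ the associated Δ-zonotope. Then for any two distinct points x, y ∈ R_Δ there exists an index i ∈ {0,…,d} such that y − x ∈ cone(F_i) and vol((y + cone(F_i)) ∩ R_Δ) < vol((x + cone(F_i)) ∩ R_Δ). -/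
open MeasureTheory

noncomputable section

/-- The linear map `t ↦ ∑ k, t k • a k`. -/
def combo {d : ℕ} (a : Fin (d + 1) → EuclideanSpace ℝ (Fin d)) :
    (Fin (d + 1) → ℝ) →ₗ[ℝ] EuclideanSpace ℝ (Fin d) :=
  Fintype.linearCombination ℝ a

lemma combo_apply {d : ℕ} (a : Fin (d + 1) → EuclideanSpace ℝ (Fin d)) (t : Fin (d + 1) → ℝ) :
    combo a t = ∑ k, t k • a k :=
  Fintype.linearCombination_apply ℝ a t

lemma combo_sub_const {d : ℕ} {a : Fin (d + 1) → EuclideanSpace ℝ (Fin d)}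
    (hbary : ∑ i, a i = 0) (t : Fin (d + 1) → ℝ) (c : ℝ) :
    combo a (fun k => t k - c) = combo a t := by
  simp [combo_apply, sub_smul, ← Finset.smul_sum, hbary]

/-- The kernel of `combo a` consists of constant vectors. -/
lemma eq_of_combo_eq_zero {d : ℕ} {a : Fin (d + 1) → EuclideanSpace ℝ (Fin d)}
    (hnondeg : LinearIndependent ℝ (fun i : Fin d => a i.succ - a 0))
    (hbary : ∑ i, a i = 0) {t : Fin (d + 1) → ℝ} (ht : combo a t = 0)
    (k l : Fin (d + 1)) : t k = t l := by
  set m : ℝ := (∑ k, t k) / (d + 1) with hm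
  have hd : (d + 1 : ℝ) ≠ 0 := by positivity
  have hsum : ∑ k, (t k - m) = 0 := by
    simp only [Finset.sum_sub_distrib, Finset.sum_const, Finset.card_univ, Fintype.card_fin,
      nsmul_eq_mul, hm]
    push_cast
    field_simp
    ring
  have hcombo : ∑ k, (t k - m) • (a k - a 0) = 0 := by
    rw [← combo_sub_const hbary t m, combo_apply] at ht
    simp only [smul_sub, Finset.sum_sub_distrib, ← Finset.sum_smul, hsum, zero_smul, sub_zero]
    exact ht
  rw [Fin.sum_univ_succ] at hcombo hsum
  simp only [sub_self, smul_zero, zero_add] at hcombo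
  have hsucc := Fintype.linearIndependent_iff.1 hnondeg _ hcombo
  have hzero : t 0 - m = 0 := by simpa [hsucc] using hsum
  have hall : ∀ k, t k = m := fun k => by
    induction k using Fin.cases with
    | zero => exact sub_eq_zero.1 hzero
    | succ i => exact sub_eq_zero.1 (hsucc i)
  rw [hall k, hall l]

lemma sub_eq_sub_of_combo_eq {d : ℕ} {a : Fin (d + 1) → EuclideanSpace ℝ (Fin d)}
    (hnondeg : LinearIndependent ℝ (fun i : Fin d => a i.succ - a 0))
    (hbary : ∑ i, a i = 0) {s t : Fin (d + 1) → ℝ} (h : combo a s = combo a t)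
    (k l : Fin (d + 1)) : s k - s l = t k - t l := by
  have := eq_of_combo_eq_zero hnondeg hbary (t := s - t) (by rw [map_sub, h, sub_self]) k l
  simp only [Pi.sub_apply] at this
  linarith

lemma combo_surjective {d : ℕ} {a : Fin (d + 1) → EuclideanSpace ℝ (Fin d)}
    (hnondeg : LinearIndependent ℝ (fun i : Fin d => a i.succ - a 0)) :
    Function.Surjective (combo a) := by
  rw [← LinearMap.range_eq_top, eq_top_iff,
    ← hnondeg.span_eq_top_of_card_eq_finrank' (by simp), Submodule.span_le]
  rintro _ ⟨i, rfl⟩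
  exact ⟨Pi.single i.succ 1 - Pi.single 0 1, by simp [combo]⟩

lemma isOpenMap_combo {d : ℕ} {a : Fin (d + 1) → EuclideanSpace ℝ (Fin d)}
    (hnondeg : LinearIndependent ℝ (fun i : Fin d => a i.succ - a 0)) :
    IsOpenMap (combo a) :=
  (LinearMap.toContinuousLinearMap (combo a)).isOpenMap (combo_surjective hnondeg)

lemma combo_mem_coneFace_iff {d : ℕ} {a : Fin (d + 1) → EuclideanSpace ℝ (Fin d)}
    (hnondeg : LinearIndependent ℝ (fun i : Fin d => a i.succ - a 0))
    (hbary : ∑ i, a i = 0) {t : Fin (d + 1) → ℝ} {i : Fin (d + 1)} :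
    combo a t ∈ coneFace a i ↔ ∀ k, t i ≤ t k := by
  constructor
  · rintro ⟨s, hs, hsi, h⟩ k
    have := sub_eq_sub_of_combo_eq hnondeg hbary (h.trans (combo_apply a s).symm) k i
    linarith [hs k]
  · intro h
    refine ⟨fun k => t k - t i, fun k => sub_nonneg.2 (h k), sub_self _, ?_⟩
    rw [← combo_apply, combo_sub_const hbary]

lemma combo_mem_zonotope_iff {d : ℕ} {a : Fin (d + 1) → EuclideanSpace ℝ (Fin d)}
    (hnondeg : LinearIndependent ℝ (fun i : Fin d => a i.succ - a 0))
    (hbary : ∑ i, a i = 0) {t : Fin (d + 1) → ℝ} :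
    combo a t ∈ zonotope a ↔ ∀ k l, t k - t l ≤ 1 := by
  constructor
  · rintro ⟨s, hs, h⟩ k l
    rw [sub_eq_sub_of_combo_eq hnondeg hbary (h.trans (combo_apply a s).symm) k l]
    linarith [(hs k).2, (hs l).1]
  · intro h
    obtain ⟨m, hm⟩ := Finite.exists_min t
    refine ⟨fun k => t k - t m, fun k => ⟨sub_nonneg.2 (hm k), h k m⟩, ?_⟩
    rw [← combo_apply, combo_sub_const hbary]

lemma combo_mem_translate_coneFace_iff {d : ℕ} {a : Fin (d + 1) → EuclideanSpace ℝ (Fin d)}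
    (hnondeg : LinearIndependent ℝ (fun i : Fin d => a i.succ - a 0))
    (hbary : ∑ i, a i = 0) {s t : Fin (d + 1) → ℝ} {i : Fin (d + 1)} :
    combo a t ∈ (combo a s + ·) '' coneFace a i ↔ ∀ k, t i - s i ≤ t k - s k := by
  rw [Set.image_add_left, Set.mem_preimage, neg_add_eq_sub, ← map_sub,
    combo_mem_coneFace_iff hnondeg hbary]
  rfl

lemma volume_zonotope_lt_top {d : ℕ} (a : Fin (d + 1) → EuclideanSpace ℝ (Fin d)) :
    volume (zonotope a) < ⊤ := by
  have h : zonotope a = combo a '' Set.Icc 0 1 := by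
    ext z
    simp only [zonotope, Set.mem_ofPred_eq, Set.mem_image, combo_apply, Set.mem_Icc, Pi.le_def,
      Pi.zero_apply, Pi.one_apply, forall_and, eq_comm (a := z)]
  rw [h]
  exact (isCompact_Icc.image (combo a).continuous_of_finiteDimensional).measure_lt_top

lemma exists_min_of_ties_max {ι : Type*} [Finite ι] [Nonempty ι] (w u : ι → ℝ) :
    ∃ i, (∀ k, w i ≤ w k) ∧ ∀ k, w k ≤ w i → u k ≤ u i := by
  obtain ⟨m, hm⟩ := Finite.exists_min w
  obtain ⟨i, hi, hmax⟩ := Set.exists_max_image {k | w k ≤ w m} u (Set.toFinite _) ⟨m, by simp⟩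
  exact ⟨i, fun k => hi.trans (hm k), fun k hk => hmax k (hk.trans hi)⟩

lemma measure_lt_of_disjoint_open {X : Type*} [TopologicalSpace X] [MeasurableSpace X]
    [OpensMeasurableSpace X] {μ : Measure X} [μ.IsOpenPosMeasure] {A B U : Set X}
    (hAB : A ⊆ B) (hUB : U ⊆ B) (hAU : Disjoint A U) (hU : IsOpen U) (hne : U.Nonempty)
    (hA : μ A ≠ ⊤) : μ A < μ B :=
  calc μ A < μ A + μ U := ENNReal.lt_add_right hA (hU.measure_pos μ hne).ne'
    _ = μ (A ∪ U) := (measure_union hAU hU.measurableSet).symm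
    _ ≤ μ B := measure_mono (Set.union_subset hAB hUB)

/-- If `u` and `v` are parameters of `x` and `y`, the vector `t` parametrizes an interior point of
`(x + cone (F i)) ∩ R_Δ` outside `y + cone (F i)`. -/
lemma exists_param_between {ι : Type*} [Finite ι] {u v : ι → ℝ} {i j : ι}
    (hu : ∀ k, u k ∈ Set.Icc (0 : ℝ) 1) (hui : ∀ k, u k - u i < 1)
    (hij : v i - u i < v j - u j) :
    ∃ t : ι → ℝ, (∀ k l, t k - t l < 1) ∧
      (∀ k, k ≠ i → t i - u i < t k - u k) ∧ t j - t i < v j - v i := by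
  classical
  have : Nonempty ι := ⟨i⟩
  obtain ⟨m, hm⟩ := Finite.exists_max u
  obtain ⟨ε, hε, hε'⟩ : ∃ ε > 0, ε < min (1 / 2) (min ((1 - (u m - u i)) / 2)
      (((v j - u j) - (v i - u i)) / 2)) :=
    exists_between (by
      have := hui m
      refine lt_min (by norm_num) (lt_min ?_ ?_) <;> linarith)
  simp only [lt_min_iff] at hε'
  obtain ⟨h1, h2, h3⟩ := hε'
  have hpos : ∀ k, 0 ≤ ε * u k := fun k => mul_nonneg hε.le (hu k).1
  have hle : ∀ k, ε * u k ≤ ε := fun k => mul_le_of_le_one_right hε.le (hu k).2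
  have hji : j ≠ i := by rintro rfl; exact lt_irrefl _ hij
  have hti : ∀ k, k ≠ i → Function.update (fun k => u k + ε * (2 - u k)) i (u i) k
      = u k + (2 * ε - ε * u k) := fun k hk => by
    rw [Function.update_of_ne hk]; ring
  refine ⟨Function.update (fun k => u k + ε * (2 - u k)) i (u i), fun k l => ?_,
    fun k hk => ?_, ?_⟩
  · by_cases hk : k = i <;> by_cases hl : l = i
    · simp [hk, hl]
    · rw [hti l hl, hk, Function.update_self]
      linarith [hle l, (hu i).2, (hu l).1]
    · rw [hti k hk, hl, Function.update_self]
      linarith [hpos k, hm k]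
    · rw [hti k hk, hti l hl]
      have : (1 - ε) * (u k - u l) ≤ (1 - ε) * 1 :=
        mul_le_mul_of_nonneg_left (by linarith [(hu k).2, (hu l).1]) (by linarith)
      linarith
  · rw [hti k hk, Function.update_self]
    linarith [hle k]
  · rw [hti j hji, Function.update_self]
    linarith [hpos j]

/-- **Strict monotonicity of illuminated volumes.** For a non-degenerate simplex
`Δ ⊂ ℝ^d` with barycenter at the origin and any two distinct points
`x, y ∈ R_Δ`, there is an index `i` with `y - x ∈ cone (F i)` and
`vol ((y + cone (F i)) ∩ R_Δ) < vol ((x + cone (F i)) ∩ R_Δ)`. -/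
theorem illuminated_volume_strict_monotone (d : ℕ)
    (a : Fin (d + 1) → EuclideanSpace ℝ (Fin d))
    (hnondeg : LinearIndependent ℝ (fun i : Fin d => a i.succ - a 0))
    (hbary : ∑ i, a i = 0) :
    ∀ x ∈ zonotope a, ∀ y ∈ zonotope a, x ≠ y →
      ∃ i : Fin (d + 1), y - x ∈ coneFace a i ∧
        volume ((y + ·) '' coneFace a i ∩ zonotope a) <
          volume ((x + ·) '' coneFace a i ∩ zonotope a) := by
  rintro _ ⟨u, hu, rfl⟩ _ ⟨v, hv, rfl⟩ hxy
  simp only [← combo_apply] at hxy ⊢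
  obtain ⟨i, hmin, hmax⟩ := exists_min_of_ties_max (v - u) u
  simp only [Pi.sub_apply] at hmin hmax
  have hui : ∀ k, u k - u i < 1 := fun k => by
    by_contra! h
    linarith [hmax k (by linarith [(hv k).2, (hv i).1]), (hu k).2, (hu i).1]
  obtain ⟨j, hij⟩ : ∃ j, v i - u i < v j - u j := by
    by_contra! h
    refine hxy ?_
    rw [← combo_sub_const hbary v (v i - u i)]
    congr 1
    ext k
    linarith [h k, hmin k]
  refine ⟨i, ?_, ?_⟩
  · rw [← map_sub, combo_mem_coneFace_iff hnondeg hbary]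
    exact hmin
  obtain ⟨τ, hτ, hτi, hτj⟩ := exists_param_between hu hui hij
  set O : Set (Fin (d + 1) → ℝ) := {t | (∀ k l, t k - t l < 1) ∧
    (∀ k, k ≠ i → t i - u i < t k - u k) ∧ t j - t i < v j - v i} with hO
  have hOopen : IsOpen O := by
    simp only [hO, Set.ofPred_and, Set.ofPred_forall]
    refine .inter (isOpen_iInter_of_finite fun k => isOpen_iInter_of_finite fun l => ?_)
      (.inter (isOpen_iInter_of_finite fun k => isOpen_iInter_of_finite fun _ => ?_) ?_)
    all_goals exact isOpen_lt (by fun_prop) (by fun_prop)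
  refine measure_lt_of_disjoint_open (U := combo a '' O) ?_ ?_ ?_
    (isOpenMap_combo hnondeg _ hOopen) ⟨_, τ, ⟨hτ, hτi, hτj⟩, rfl⟩
    (measure_lt_top_of_subset Set.inter_subset_right (volume_zonotope_lt_top a).ne).ne
  · rintro z ⟨hz, hzR⟩
    obtain ⟨t, rfl⟩ := combo_surjective hnondeg z
    rw [combo_mem_translate_coneFace_iff hnondeg hbary] at hz
    refine ⟨(combo_mem_translate_coneFace_iff hnondeg hbary).2 fun k => ?_, hzR⟩
    linarith [hz k, hmin k]
  · rintro _ ⟨t, ⟨ht, hti, -⟩, rfl⟩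
    refine ⟨(combo_mem_translate_coneFace_iff hnondeg hbary).2 fun k => ?_,
      (combo_mem_zonotope_iff hnondeg hbary).2 fun k l => (ht k l).le⟩
    rcases eq_or_ne k i with rfl | hk
    exacts [le_rfl, (hti k hk).le]
  · rw [Set.disjoint_left]
    rintro _ ⟨hz, -⟩ ⟨t, ⟨-, -, htj⟩, rfl⟩
    linarith [(combo_mem_translate_coneFace_iff hnondeg hbary).1 hz j]
end
end
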